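/- arXiv:math/0211074 — 2 statements merged into one kernel-verified Lean document; each statement's English description precedes it below -/
import Mathlib

section
/- Let A be an ε-bialgebra over a commutative ring k and let ∘ be the operation a ∘ b := b₁·a·b₂ (where Δ(b) = b₁ ⊗ b₂). Then for every c ∈ A the map L_c : A → A, L_c(a) = c ∘ a, is a derivation of the associative algebra A: c ∘ (a·b) = a·(c ∘ b) + (c ∘ a)·b for all a, b ∈ A. -/
open TensorProduct

/-- The map `A ⊗ A →ₗ A`, `x ⊗ y ↦ x * a * y`. -/
noncomputable def sandwich (k : Type*) {A : Type*} [CommRing k] [NonUnitalRing A]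
    [Module k A] [SMulCommClass k A A] [IsScalarTower k A A] (a : A) :
    A ⊗[k] A →ₗ[k] A :=
  TensorProduct.lift (LinearMap.mk₂ k (fun x y => x * a * y)
    (fun x x' y => by simp [add_mul])
    (fun c x y => by simp [smul_mul_assoc])
    (fun x y y' => by simp [mul_add])
    (fun c x y => by simp [mul_smul_comm]))

theorem sandwich_map_mulLeft {k A : Type*} [CommRing k] [NonUnitalRing A]
    [Module k A] [SMulCommClass k A A] [IsScalarTower k A A] (a c : A) (t : A ⊗[k] A) :
    sandwich k c (TensorProduct.map (LinearMap.mulLeft k a) LinearMap.id t) =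
      a * sandwich k c t := by
  induction t with
  | zero => simp
  | tmul x y => simp [sandwich, mul_assoc]
  | add s t hs ht => simp only [map_add, mul_add, hs, ht]

theorem sandwich_map_mulRight {k A : Type*} [CommRing k] [NonUnitalRing A]
    [Module k A] [SMulCommClass k A A] [IsScalarTower k A A] (b c : A) (t : A ⊗[k] A) :
    sandwich k c (TensorProduct.map LinearMap.id (LinearMap.mulRight k b) t) =
      sandwich k c t * b := by
  induction t with
  | zero => simp
  | tmul x y => simp [sandwich, mul_assoc]
  | add s t hs ht => simp only [map_add, add_mul, hs, ht]

/-- For any ε-bialgebra `A` and `c ∈ A`, the map `L_c(a) = c ∘ a = a₁·c·a₂` is a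
derivation of the associative algebra `A`. -/
theorem epsilon_bialgebra_preLie_left_mul_derivation {k A : Type*} [CommRing k]
    [NonUnitalRing A] [Module k A] [SMulCommClass k A A] [IsScalarTower k A A]
    (Δ : A →ₗ[k] A ⊗[k] A)
    (hcoassoc : ∀ a : A,
      (TensorProduct.assoc k A A A) ((TensorProduct.map Δ LinearMap.id) (Δ a)) =
        (TensorProduct.map LinearMap.id Δ) (Δ a))
    (hder : ∀ a b : A,
      Δ (a * b) = (TensorProduct.map (LinearMap.mulLeft k a) LinearMap.id) (Δ b)
        + (TensorProduct.map LinearMap.id (LinearMap.mulRight k b)) (Δ a))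
    (circ : A → A → A)
    (hcirc : ∀ a b : A, circ a b = sandwich k a (Δ b)) :
    ∀ c a b : A, circ c (a * b) = a * circ c b + circ c a * b := by
  intro c a b
  simp only [hcirc, hder, map_add, sandwich_map_mulLeft, sandwich_map_mulRight]
end

section
/- Let A be an ε-bialgebra over a commutative ring k and let M be a left ε-Hopf module over A, with action written a·m and coaction Λ(m) = m₋₁ ⊗ m₀. Define a ∘ b := b₁·a·b₂ on A and a ∘ m := (m₋₁·a)·m₀ for a ∈ A, m ∈ M. Then M is a left pre-Lie module over the pre-Lie algebra (A, ∘): a ∘ (b ∘ m) − (a ∘ b) ∘ m = b ∘ (a ∘ m) − (b ∘ a) ∘ m for all a, b ∈ A and m ∈ M. -/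
open TensorProduct

/-- The map `A ⊗ M →ₗ M`, `x ⊗ m ↦ (x * a) · m`, for a left action `μM`. -/
noncomputable def actSandwich (k : Type*) {A M : Type*} [CommRing k] [NonUnitalRing A]
    [Module k A] [SMulCommClass k A A] [IsScalarTower k A A]
    [AddCommGroup M] [Module k M]
    (μM : A →ₗ[k] M →ₗ[k] M) (a : A) : A ⊗[k] M →ₗ[k] M :=
  TensorProduct.lift (LinearMap.mk₂ k (fun x m => μM (x * a) m)
    (fun x x' m => by simp [add_mul])
    (fun c x m => by simp [smul_mul_assoc])
    (fun x m m' => by simp)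
    (fun c x m => by simp))

section

variable {k A M : Type*} [CommRing k] [NonUnitalRing A] [Module k A] [SMulCommClass k A A]
  [IsScalarTower k A A] [AddCommGroup M] [Module k M]

@[simp]
lemma sandwich_tmul (a x y : A) : sandwich k a (x ⊗ₜ y) = x * a * y := rfl

@[simp]
lemma actSandwich_tmul (μM : A →ₗ[k] M →ₗ[k] M) (a x : A) (m : M) :
    actSandwich k μM a (x ⊗ₜ m) = μM (x * a) m := rfl

lemma sandwich_map_mulLeft_s3 (a x : A) (s : A ⊗[k] A) :
    sandwich k a (TensorProduct.map (LinearMap.mulLeft k x) LinearMap.id s)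
      = x * sandwich k a s := by
  induction s with
  | zero => simp
  | tmul p q => simp [mul_assoc]
  | add s t hs ht => simp [hs, ht, mul_add]

lemma actSandwich_map_mulLeft (μM : A →ₗ[k] M →ₗ[k] M)
    (hμM : ∀ (a b : A) (m : M), μM (a * b) m = μM a (μM b m)) (a x : A) (s : A ⊗[k] M) :
    actSandwich k μM a (TensorProduct.map (LinearMap.mulLeft k x) LinearMap.id s)
      = μM x (actSandwich k μM a s) := by
  induction s with
  | zero => simp
  | tmul p m => simp [hμM]
  | add s t hs ht => simp [hs, ht]

lemma actSandwich_map_flip (μM : A →ₗ[k] M →ₗ[k] M)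
    (hμM : ∀ (a b : A) (m : M), μM (a * b) m = μM a (μM b m)) (a : A) (m : M) (s : A ⊗[k] A) :
    actSandwich k μM a (TensorProduct.map LinearMap.id (μM.flip m) s)
      = μM (sandwich k a s) m := by
  induction s with
  | zero => simp
  | tmul p q => simp [hμM]
  | add s t hs ht => simp only [map_add, LinearMap.add_apply, hs, ht]

lemma act_sandwich_map_mulRight (μM : A →ₗ[k] M →ₗ[k] M)
    (hμM : ∀ (a b : A) (m : M), μM (a * b) m = μM a (μM b m)) (a b : A) (m : M)
    (s : A ⊗[k] A) :
    μM (sandwich k a (TensorProduct.map LinearMap.id (LinearMap.mulRight k b) s)) m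
      = actSandwich k μM a (TensorProduct.map LinearMap.id (actSandwich k μM b)
          (TensorProduct.assoc k A A M (s ⊗ₜ m))) := by
  induction s with
  | zero => simp
  | tmul p q => simp [hμM]
  | add s t hs ht => simp only [map_add, LinearMap.add_apply, add_tmul, hs, ht]

/-- The expansion of `a ∘ (b ∘ m)`, with an arbitrary tensor in place of the coaction of `m`. -/
lemma actSandwich_coaction_actSandwich
    (Δ : A →ₗ[k] A ⊗[k] A)
    (hder : ∀ a b : A,
      Δ (a * b) = (TensorProduct.map (LinearMap.mulLeft k a) LinearMap.id) (Δ b)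
        + (TensorProduct.map LinearMap.id (LinearMap.mulRight k b)) (Δ a))
    (μM : A →ₗ[k] M →ₗ[k] M)
    (hμM : ∀ (a b : A) (m : M), μM (a * b) m = μM a (μM b m))
    (Λ : M →ₗ[k] A ⊗[k] M)
    (hΛcompat : ∀ (a : A) (m : M),
      Λ (μM a m) = (TensorProduct.map (LinearMap.mulLeft k a) LinearMap.id) (Λ m)
        + (TensorProduct.map LinearMap.id (μM.flip m)) (Δ a))
    (a b : A) (t : A ⊗[k] M) :
    actSandwich k μM a (Λ (actSandwich k μM b t))
      = actSandwich k μM b (TensorProduct.map LinearMap.id (actSandwich k μM a)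
          (TensorProduct.map LinearMap.id Λ t))
        + actSandwich k μM (sandwich k a (Δ b)) t
        + actSandwich k μM a (TensorProduct.map LinearMap.id (actSandwich k μM b)
          (TensorProduct.assoc k A A M (TensorProduct.map Δ LinearMap.id t))) := by
  induction t with
  | zero => simp
  | tmul x m =>
    simp only [actSandwich_tmul, TensorProduct.map_tmul, LinearMap.id_apply, hΛcompat, hder,
      map_add, actSandwich_map_mulLeft μM hμM,
      actSandwich_map_flip μM hμM, sandwich_map_mulLeft_s3, act_sandwich_map_mulRight μM hμM]
    abel
  | add s t hs ht =>
    simp only [map_add, hs, ht]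
    abel

end

/-- A left ε-Hopf module `M` over an ε-bialgebra `A` is a left pre-Lie module over
the associated pre-Lie algebra `(A, ∘)`, via `a ∘ m := (m₋₁·a)·m₀`. -/
theorem epsilonHopfModule_preLieModule {k A M : Type*} [CommRing k]
    [NonUnitalRing A] [Module k A] [SMulCommClass k A A] [IsScalarTower k A A]
    [AddCommGroup M] [Module k M]
    (Δ : A →ₗ[k] A ⊗[k] A)
    (hcoassoc : ∀ a : A,
      (TensorProduct.assoc k A A A) ((TensorProduct.map Δ LinearMap.id) (Δ a)) =
        (TensorProduct.map LinearMap.id Δ) (Δ a))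
    (hder : ∀ a b : A,
      Δ (a * b) = (TensorProduct.map (LinearMap.mulLeft k a) LinearMap.id) (Δ b)
        + (TensorProduct.map LinearMap.id (LinearMap.mulRight k b)) (Δ a))
    (μM : A →ₗ[k] M →ₗ[k] M)
    (hμM : ∀ (a b : A) (m : M), μM (a * b) m = μM a (μM b m))
    (Λ : M →ₗ[k] A ⊗[k] M)
    (hΛcoassoc : ∀ m : M,
      (TensorProduct.assoc k A A M) ((TensorProduct.map Δ LinearMap.id) (Λ m)) =
        (TensorProduct.map LinearMap.id Λ) (Λ m))
    (hΛcompat : ∀ (a : A) (m : M),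
      Λ (μM a m) = (TensorProduct.map (LinearMap.mulLeft k a) LinearMap.id) (Λ m)
        + (TensorProduct.map LinearMap.id (μM.flip m)) (Δ a))
    (circ : A → A → A) (hcirc : ∀ a b : A, circ a b = sandwich k a (Δ b))
    (circM : A → M → M)
    (hcircM : ∀ (a : A) (m : M), circM a m = actSandwich k μM a (Λ m)) :
    ∀ (a b : A) (m : M),
      circM a (circM b m) - circM (circ a b) m
        = circM b (circM a m) - circM (circ b a) m := by
  intro a b m
  simp only [hcircM, hcirc,
    actSandwich_coaction_actSandwich Δ hder μM hμM Λ hΛcompat, hΛcoassoc]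
  abel
end
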